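/- arXiv:1307.8429 — 2 statements merged into one kernel-verified Lean document; each statement's English description precedes it below -/
import Mathlib

section
/- Let 𝒯 = {K_1, …, K_q} be a triangle patch around z ∈ ℝ² and suppose that for some index i the barycenters of K_{i−1}, K_i, K_{i+1} are not collinear. If u is a real bivariate polynomial of total degree ≤ 1 whose restriction to each of K_{i−1}, K_i, K_{i+1} is orthogonal to the constant functions with respect to (·,·)_{K_j} (j = i−1, i, i+1), then u = 0. In other words, P_0^⊥(K_{i−1}) ∩ P_0^⊥(K_i) ∩ P_0^⊥(K_{i+1}) = {0}. -/
open MeasureTheory Finset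

noncomputable section

/-- 2×2 determinant of two vectors in `ℝ²`. -/
def det2 (u v : ℝ × ℝ) : ℝ := u.1 * v.2 - u.2 * v.1

/-- The open triangle with vertices `A`, `B`, `C` (interior of the convex hull). -/
def tri (A B C : ℝ × ℝ) : Set (ℝ × ℝ) := interior (convexHull ℝ {A, B, C})

/-- Barycentric coordinate of `p` with respect to the vertex `A` of triangle `ABC`. -/
def bary (A B C p : ℝ × ℝ) : ℝ := det2 (p - B) (C - B) / det2 (A - B) (C - B)

/-- The cubic bubble: product of the three barycentric coordinates of triangle `ABC`. -/
def bubble (A B C p : ℝ × ℝ) : ℝ := bary A B C p * bary B C A p * bary C A B p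

/-- Evaluation of a bivariate polynomial at a point of `ℝ²`. -/
def evalP (u : MvPolynomial (Fin 2) ℝ) (p : ℝ × ℝ) : ℝ :=
  MvPolynomial.eval ![p.1, p.2] u

/-- The inner product `(u,v)_K := ∫_K u v ω_K` on the open triangle `K = conv°(A,B,C)`,
with weight the product of the barycentric coordinates. -/
def innerT (A B C : ℝ × ℝ) (u v : MvPolynomial (Fin 2) ℝ) : ℝ :=
  ∫ p in tri A B C, evalP u p * evalP v p * bubble A B C p

/-- `u ∈ P_{n-1}^⊥(K)` for `K = conv°(A,B,C)`: `u` has total degree at most `n` and is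
orthogonal to every polynomial of total degree at most `n-1` w.r.t. `(·,·)_K`. -/
def inPerp (n : ℕ) (A B C : ℝ × ℝ) (u : MvPolynomial (Fin 2) ℝ) : Prop :=
  u.totalDegree ≤ n ∧
    ∀ w : MvPolynomial (Fin 2) ℝ, w.totalDegree ≤ n - 1 → innerT A B C u w = 0

/-- A triangle patch around a point `z`: `q ≥ 3` pairwise disjoint nondegenerate open
triangles `K_i = conv°(z, A_{i-1}, A_i)` (indices cyclic, i.e. in `ZMod q`), consecutive ones
sharing the edge from `z` to `A_i`, whose closed union covers a neighbourhood of `z`. -/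
structure TrianglePatch (q : ℕ) where
  hq : 3 ≤ q
  z : ℝ × ℝ
  A : ZMod q → ℝ × ℝ
  indep : ∀ i : ZMod q, AffineIndependent ℝ ![z, A (i - 1), A i]
  disj : Pairwise fun i j : ZMod q =>
    Disjoint (tri z (A (i - 1)) (A i)) (tri z (A (j - 1)) (A j))
  covers : ∃ ε > 0, Metric.ball z ε ⊆ ⋃ i : ZMod q, closure (tri z (A (i - 1)) (A i))

/-- The `i`-th triangle of a patch. -/
def TrianglePatch.K {q : ℕ} (T : TrianglePatch q) (i : ZMod q) : Set (ℝ × ℝ) :=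
  tri T.z (T.A (i - 1)) (T.A i)

/-- `Ω`: the interior of the union of the closed triangles of the patch. -/
def TrianglePatch.Omega {q : ℕ} (T : TrianglePatch q) : Set (ℝ × ℝ) :=
  interior (⋃ i : ZMod q, closure (tri T.z (T.A (i - 1)) (T.A i)))

/-- The patch inner product `(u,v)_𝒯 = Σ_i (u_i, v_i)_{K_i}` of two piecewise polynomials
(given as tuples of polynomials, one for each triangle). -/
def patchInner {q : ℕ} (T : TrianglePatch q)
    (u v : ZMod q → MvPolynomial (Fin 2) ℝ) : ℝ :=
  haveI : NeZero q := ⟨by have := T.hq; omega⟩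
  ∑ i : ZMod q, innerT T.z (T.A (i - 1)) (T.A i) (u i) (v i)

/-- The barycenter `M_i = (z + A_{i-1} + A_i)/3` of the `i`-th triangle of a patch. -/
def TrianglePatch.M {q : ℕ} (T : TrianglePatch q) (i : ZMod q) : ℝ × ℝ :=
  (3⁻¹ : ℝ) • (T.z + T.A (i - 1) + T.A i)

lemma det2_cycle (A B C : ℝ × ℝ) : det2 (B - C) (A - C) = det2 (A - B) (C - B) := by
  simp only [det2, Prod.fst_sub, Prod.snd_sub]; ring

lemma continuous_bary (A B C : ℝ × ℝ) : Continuous (bary A B C) := by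
  unfold bary det2
  fun_prop

lemma continuous_bubble (A B C : ℝ × ℝ) : Continuous (bubble A B C) :=
  ((continuous_bary A B C).mul (continuous_bary B C A)).mul (continuous_bary C A B)

lemma bary_sum {A B C : ℝ × ℝ} (h : det2 (A - B) (C - B) ≠ 0) (p : ℝ × ℝ) :
    bary A B C p + bary B C A p + bary C A B p = 1 := by
  rw [bary, bary, bary, ← det2_cycle C A B, det2_cycle A B C, ← add_div, ← add_div,
    div_eq_one_iff_eq h]
  simp only [det2, Prod.fst_sub, Prod.snd_sub]; ring

lemma bary_reconstruct {A B C : ℝ × ℝ} (h : det2 (A - B) (C - B) ≠ 0) (p : ℝ × ℝ) :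
    bary A B C p • A + bary B C A p • B + bary C A B p • C = p := by
  rw [bary, bary, bary, ← det2_cycle C A B, det2_cycle A B C]
  ext <;>
  · simp only [Prod.fst_add, Prod.snd_add, Prod.smul_fst, Prod.smul_snd, smul_eq_mul]
    field_simp
    simp only [det2, Prod.fst_sub, Prod.snd_sub]; ring

/-- Barycentric coordinates are affine. -/
lemma bary_combo (A B C p q r : ℝ × ℝ) {a b c : ℝ} (h : a + b + c = 1) :
    bary A B C (a • p + b • q + c • r) =
      a * bary A B C p + b * bary A B C q + c * bary A B C r := by
  obtain rfl : a = 1 - b - c := by linarith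
  simp only [bary, det2, Prod.fst_sub, Prod.snd_sub, Prod.fst_add, Prod.snd_add, Prod.smul_fst,
    Prod.smul_snd, smul_eq_mul]
  ring

lemma bary_self {A B C : ℝ × ℝ} (h : det2 (A - B) (C - B) ≠ 0) : bary A B C A = 1 :=
  div_self h

lemma bary_left (A B C : ℝ × ℝ) : bary A B C B = 0 := by
  simp [bary, det2]

lemma bary_right (A B C : ℝ × ℝ) : bary A B C C = 0 := by
  simp [bary, det2, mul_comm]

lemma convexHull_triangle {A B C : ℝ × ℝ} (h : det2 (A - B) (C - B) ≠ 0) :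
    convexHull ℝ {A, B, C} =
      {p | 0 ≤ bary A B C p ∧ 0 ≤ bary B C A p ∧ 0 ≤ bary C A B p} := by
  have h' : det2 (B - C) (A - C) ≠ 0 := by rwa [det2_cycle]
  have h'' : det2 (C - A) (B - A) ≠ 0 := by rwa [det2_cycle, det2_cycle]
  ext p
  constructor
  · intro hp
    have key : ∀ X Y Z : ℝ × ℝ, Convex ℝ {p | 0 ≤ bary X Y Z p} := by
      intro X Y Z x hx y hy a b ha hb hab
      have := bary_combo X Y Z x y 0 (a := a) (b := b) (c := 0) (by linarith)
      simp only [zero_smul, add_zero, zero_mul] at this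
      rw [Set.mem_ofPred_eq] at hx hy ⊢
      rw [this]; positivity
    refine convexHull_min ?_ ((key A B C).inter ((key B C A).inter (key C A B))) hp
    rintro x (rfl | rfl | rfl) <;>
      simp [bary_self, bary_left, bary_right, h, h', h'']
  · rintro ⟨h1, h2, h3⟩
    rw [← bary_reconstruct h p]
    have hs := bary_sum h p
    have hc := convex_convexHull ℝ ({A, B, C} : Set (ℝ × ℝ))
    have := hc.sum_mem (t := Finset.univ) (w := ![bary A B C p, bary B C A p, bary C A B p])
      (z := ![A, B, C])
      (by intro i _; fin_cases i <;> simpa)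
      (by simpa [Fin.sum_univ_three] using hs)
      (by intro i _; fin_cases i <;> exact subset_convexHull ℝ _ (by simp))
    simpa [Fin.sum_univ_three] using this

/-- The affine map permuting the vertices of a triangle cyclically. -/
def rot (A B C p : ℝ × ℝ) : ℝ × ℝ := bary A B C p • B + bary B C A p • C + bary C A B p • A

lemma continuous_rot (A B C : ℝ × ℝ) : Continuous (rot A B C) := by
  have := continuous_bary A B C
  have := continuous_bary B C A
  have := continuous_bary C A B
  unfold rot
  fun_prop

lemma bary_rot_fst {A B C : ℝ × ℝ} (h : det2 (A - B) (C - B) ≠ 0) (p : ℝ × ℝ) :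
    bary A B C (rot A B C p) = bary C A B p := by
  rw [rot, bary_combo _ _ _ _ _ _ (bary_sum h p), bary_left, bary_right, bary_self h]; ring

lemma bary_rot_snd {A B C : ℝ × ℝ} (h : det2 (A - B) (C - B) ≠ 0) (p : ℝ × ℝ) :
    bary B C A (rot A B C p) = bary A B C p := by
  have h' : det2 (B - C) (A - C) ≠ 0 := by rwa [det2_cycle]
  rw [rot, bary_combo _ _ _ _ _ _ (bary_sum h p), bary_left, bary_right, bary_self h']; ring

lemma bary_rot_thd {A B C : ℝ × ℝ} (h : det2 (A - B) (C - B) ≠ 0) (p : ℝ × ℝ) :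
    bary C A B (rot A B C p) = bary B C A p := by
  have h' : det2 (C - A) (B - A) ≠ 0 := by rwa [det2_cycle, det2_cycle]
  rw [rot, bary_combo _ _ _ _ _ _ (bary_sum h p), bary_left, bary_right, bary_self h']; ring

lemma bubble_rot {A B C : ℝ × ℝ} (h : det2 (A - B) (C - B) ≠ 0) (p : ℝ × ℝ) :
    bubble A B C (rot A B C p) = bubble A B C p := by
  rw [bubble, bary_rot_fst h, bary_rot_snd h, bary_rot_thd h, bubble]; ring

lemma rot_rot_rot {A B C : ℝ × ℝ} (h : det2 (A - B) (C - B) ≠ 0) (p : ℝ × ℝ) :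
    rot A B C (rot A B C (rot A B C p)) = p := by
  conv_lhs => rw [rot]
  simp only [bary_rot_fst h, bary_rot_snd h, bary_rot_thd h]
  conv_rhs => rw [← bary_reconstruct h p]
  abel

lemma add_rot_add_rot_rot {A B C : ℝ × ℝ} (h : det2 (A - B) (C - B) ≠ 0) (p : ℝ × ℝ) :
    p + rot A B C p + rot A B C (rot A B C p) = A + B + C := by
  have e : rot A B C (rot A B C p) =
      bary C A B p • B + bary A B C p • C + bary B C A p • A := by
    rw [rot, bary_rot_fst h, bary_rot_snd h, bary_rot_thd h]
  rw [e, rot]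
  conv_lhs =>
    enter [1, 1]
    rw [← bary_reconstruct h p]
  rw [← one_smul ℝ (A + B + C), ← bary_sum h p]
  module

lemma rot_preimage_convexHull {A B C : ℝ × ℝ} (h : det2 (A - B) (C - B) ≠ 0) :
    rot A B C ⁻¹' convexHull ℝ {A, B, C} = convexHull ℝ {A, B, C} := by
  rw [convexHull_triangle h]
  ext p
  simp only [Set.mem_preimage, Set.mem_ofPred_eq, bary_rot_fst h, bary_rot_snd h, bary_rot_thd h]
  tauto

lemma measurePreserving_rot {A B C : ℝ × ℝ} (h : det2 (A - B) (C - B) ≠ 0) :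
    MeasurePreserving (rot A B C) := by
  have hmap : ∀ a b : ℝ, ∀ x y, rot A B C (a • x + b • y) - rot A B C 0 =
      a • (rot A B C x - rot A B C 0) + b • (rot A B C y - rot A B C 0) := by
    intro a b x y
    have hb : ∀ X Y Z : ℝ × ℝ, bary X Y Z (a • x + b • y) =
        a * bary X Y Z x + b * bary X Y Z y + (1 - a - b) * bary X Y Z 0 := by
      intro X Y Z
      rw [← bary_combo X Y Z x y 0 (by ring), smul_zero, add_zero]
    simp only [rot, hb]
    module
  obtain ⟨L, c, hL⟩ : ∃ (L : (ℝ × ℝ) →ₗ[ℝ] (ℝ × ℝ)) (c : ℝ × ℝ), ∀ p, rot A B C p = L p + c :=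
    ⟨{ toFun := fun p => rot A B C p - rot A B C 0
       map_add' := fun x y => by simpa using hmap 1 1 x y
       map_smul' := fun a x => by simpa using hmap a 0 x 0 }, rot A B C 0, fun p => by simp⟩
  have hL3 : L ^ 3 = 1 := by
    apply LinearMap.ext
    intro p
    have e1 := rot_rot_rot h p
    have e2 := rot_rot_rot h 0
    simp only [hL, map_add, map_zero] at e1 e2
    rw [pow_succ, pow_two]
    simp only [Module.End.mul_apply, Module.End.one_apply]
    linear_combination e1 - e2
  have hdet : LinearMap.det L = 1 := by
    have : LinearMap.det L ^ 3 = 1 := by rw [← map_pow, hL3, map_one]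
    exact (pow_eq_one_iff_of_ne_zero (by norm_num)).1 this |>.resolve_right (by
      rintro ⟨-, h3⟩; exact absurd h3 (by decide))
  have hmL : MeasurePreserving L := by
    refine ⟨L.continuous_of_finiteDimensional.measurable, ?_⟩
    rw [Measure.map_linearMap_addHaar_eq_smul_addHaar _ (by rw [hdet]; exact one_ne_zero), hdet]
    simp
  rw [funext hL]
  exact (measurePreserving_add_right (volume : Measure (ℝ × ℝ)) c).comp hmL

lemma setIntegral_rot {A B C : ℝ × ℝ} (h : det2 (A - B) (C - B) ≠ 0) (f : ℝ × ℝ → ℝ) :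
    ∫ p in convexHull ℝ {A, B, C}, f (rot A B C p) = ∫ p in convexHull ℝ {A, B, C}, f p := by
  have hinj : Function.Injective (rot A B C) :=
    Function.LeftInverse.injective (g := fun p => rot A B C (rot A B C p)) (rot_rot_rot h)
  have := (measurePreserving_rot h).setIntegral_preimage_emb
    ((continuous_rot A B C).measurableEmbedding hinj) f (convexHull ℝ {A, B, C})
  rwa [rot_preimage_convexHull h] at this

lemma setIntegral_bubble_pos {A B C : ℝ × ℝ} (h : det2 (A - B) (C - B) ≠ 0) :
    0 < ∫ p in convexHull ℝ {A, B, C}, bubble A B C p := by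
  have h' : det2 (B - C) (A - C) ≠ 0 := by rwa [det2_cycle]
  have h'' : det2 (C - A) (B - A) ≠ 0 := by rwa [det2_cycle, det2_cycle]
  have hcomp : IsCompact (convexHull ℝ {A, B, C}) :=
    (Set.toFinite _).isCompact_convexHull (𝕜 := ℝ)
  let S : Set (ℝ × ℝ) := {p | 0 < bary A B C p} ∩ ({p | 0 < bary B C A p} ∩ {p | 0 < bary C A B p})
  have hSopen : IsOpen S :=
    (isOpen_lt continuous_const (continuous_bary A B C)).inter
      ((isOpen_lt continuous_const (continuous_bary B C A)).inter
        (isOpen_lt continuous_const (continuous_bary C A B)))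
  have hSne : S.Nonempty := by
    refine ⟨(3⁻¹ : ℝ) • A + (3⁻¹ : ℝ) • B + (3⁻¹ : ℝ) • C, ?_, ?_, ?_⟩ <;>
      rw [Set.mem_ofPred_eq, bary_combo _ _ _ _ _ _ (by norm_num)] <;>
      simp [bary_self, bary_left, bary_right, h, h', h'']
  rw [setIntegral_pos_iff_support_of_nonneg_ae]
  · refine (hSopen.measure_pos volume hSne).trans_le (measure_mono ?_)
    rintro p ⟨h1, h2, h3⟩
    rw [Set.mem_ofPred_eq] at h1 h2 h3
    refine ⟨?_, ?_⟩
    · rw [Function.mem_support, bubble]; positivity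
    · rw [convexHull_triangle h]; exact ⟨h1.le, h2.le, h3.le⟩
  · refine (ae_restrict_iff' hcomp.measurableSet).2 (Filter.Eventually.of_forall fun p hp => ?_)
    rw [convexHull_triangle h] at hp
    exact mul_nonneg (mul_nonneg hp.1 hp.2.1) hp.2.2
  · exact (continuous_bubble A B C).continuousOn.integrableOn_compact hcomp

/-- An affine function integrated against the bubble is its value at the barycenter times the
integral of the bubble. -/
lemma setIntegral_affine_mul_bubble {A B C : ℝ × ℝ} (h : det2 (A - B) (C - B) ≠ 0) (a b c : ℝ) :
    3 * ∫ p in convexHull ℝ {A, B, C}, (a + b * p.1 + c * p.2) * bubble A B C p =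
      (3 * a + b * (A + B + C).1 + c * (A + B + C).2) *
        ∫ p in convexHull ℝ {A, B, C}, bubble A B C p := by
  have hcomp : IsCompact (convexHull ℝ {A, B, C}) :=
    (Set.toFinite _).isCompact_convexHull (𝕜 := ℝ)
  set f : ℝ × ℝ → ℝ := fun p => (a + b * p.1 + c * p.2) * bubble A B C p with hf
  have hfc : Continuous f := by
    have := continuous_bubble A B C
    fun_prop
  have hr := continuous_rot A B C
  have hint : ∀ g : ℝ × ℝ → ℝ, Continuous g → IntegrableOn g (convexHull ℝ {A, B, C}) :=
    fun g hg => hg.continuousOn.integrableOn_compact hcomp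
  have e1 := setIntegral_rot h f
  have e2 := setIntegral_rot h fun p => f (rot A B C p)
  have hsum : ∀ p, f p + f (rot A B C p) + f (rot A B C (rot A B C p)) =
      (3 * a + b * (A + B + C).1 + c * (A + B + C).2) * bubble A B C p := by
    intro p
    simp only [hf, bubble_rot h, ← add_rot_add_rot_rot h p, Prod.fst_add, Prod.snd_add]
    ring
  rw [← integral_const_mul (_ + _ + _), ← funext hsum, integral_add, integral_add, e2, e1]
  · ring
  · exact hint _ hfc
  · exact hint _ (hfc.comp hr)
  · exact hint _ (hfc.add (hfc.comp hr))
  · exact hint _ ((hfc.comp hr).comp hr)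

lemma innerT_eq_setIntegral_convexHull (A B C : ℝ × ℝ) (u v : MvPolynomial (Fin 2) ℝ) :
    innerT A B C u v =
      ∫ p in convexHull ℝ {A, B, C}, evalP u p * evalP v p * bubble A B C p :=
  setIntegral_congr_set
    (interior_ae_eq_of_null_frontier ((convex_convexHull ℝ _).addHaar_frontier volume))

lemma collinear_of_det2_eq_zero {A B C : ℝ × ℝ} (h : det2 (A - B) (C - B) = 0) :
    Collinear ℝ {A, B, C} := by
  rw [collinear_iff_of_mem (p₀ := B) (by simp)]
  by_cases hAB : A = B
  · refine ⟨C - B, ?_⟩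
    rintro p (rfl | rfl | rfl)
    · exact ⟨0, by simp [hAB]⟩
    · exact ⟨0, by simp⟩
    · exact ⟨1, by simp⟩
  · refine ⟨A - B, ?_⟩
    rintro p (rfl | rfl | rfl)
    · exact ⟨1, by simp⟩
    · exact ⟨0, by simp⟩
    · have hn : (A.1 - B.1) ^ 2 + (A.2 - B.2) ^ 2 ≠ 0 := by
        intro h0
        apply hAB
        ext <;> nlinarith [sq_nonneg (A.1 - B.1), sq_nonneg (A.2 - B.2)]
      refine ⟨((p.1 - B.1) * (A.1 - B.1) + (p.2 - B.2) * (A.2 - B.2)) /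
        ((A.1 - B.1) ^ 2 + (A.2 - B.2) ^ 2), ?_⟩
      simp only [det2, Prod.fst_sub, Prod.snd_sub] at h
      ext
      · simp only [vadd_eq_add, Prod.fst_add, Prod.smul_fst, Prod.fst_sub, smul_eq_mul]
        field_simp
        linear_combination (-(A.2 - B.2)) * h
      · simp only [vadd_eq_add, Prod.snd_add, Prod.smul_snd, Prod.snd_sub, smul_eq_mul]
        field_simp
        linear_combination (A.1 - B.1) * h

lemma det2_ne_zero_of_affineIndependent {A B C : ℝ × ℝ}
    (h : AffineIndependent ℝ ![A, B, C]) : det2 (A - B) (C - B) ≠ 0 :=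
  fun h0 => affineIndependent_iff_not_collinear_set.1 h (collinear_of_det2_eq_zero h0)

lemma support_subset_of_totalDegree_le_one {u : MvPolynomial (Fin 2) ℝ}
    (hu : u.totalDegree ≤ 1) :
    u.support ⊆ {0, Finsupp.single 0 1, Finsupp.single 1 1} := by
  intro m hm
  have h1 : m.degree ≤ 1 := (MvPolynomial.le_totalDegree hm).trans hu
  rw [Finsupp.degree_eq_sum, Fin.sum_univ_two] at h1
  have h2 : (m 0 = 0 ∧ m 1 = 0) ∨ (m 0 = 1 ∧ m 1 = 0) ∨ (m 0 = 0 ∧ m 1 = 1) := by omega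
  simp only [Finset.mem_insert, Finset.mem_singleton]
  refine h2.imp ?_ (Or.imp ?_ ?_) <;>
  · rintro ⟨h0, h1⟩
    ext j
    fin_cases j <;> simp [h0, h1]

lemma evalP_of_totalDegree_le_one {u : MvPolynomial (Fin 2) ℝ} (hu : u.totalDegree ≤ 1)
    (p : ℝ × ℝ) :
    evalP u p = u.coeff 0 + u.coeff (Finsupp.single 0 1) * p.1 +
      u.coeff (Finsupp.single 1 1) * p.2 := by
  rw [evalP, MvPolynomial.eval_eq', Finset.sum_subset (support_subset_of_totalDegree_le_one hu)]
  · rw [Finset.sum_insert, Finset.sum_insert, Finset.sum_singleton]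
    · simp [Fin.prod_univ_two, add_assoc]
    · simp [Finsupp.single_left_inj]
    · simp [eq_comm]
  · intro m _ hm
    rw [MvPolynomial.notMem_support_iff.1 hm, zero_mul]

/-- A polynomial of degree at most one orthogonal to the constants on a triangle vanishes at the
barycenter. -/
lemma affine_barycenter_eq_zero {A B C : ℝ × ℝ} (h : AffineIndependent ℝ ![A, B, C])
    {u : MvPolynomial (Fin 2) ℝ} (hu : u.totalDegree ≤ 1)
    (horth : ∀ w : MvPolynomial (Fin 2) ℝ, w.totalDegree ≤ 0 → innerT A B C u w = 0) :
    evalP u ((3⁻¹ : ℝ) • (A + B + C)) = 0 := by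
  have hd := det2_ne_zero_of_affineIndependent h
  have h1 := horth 1 (by simp)
  have e := setIntegral_affine_mul_bubble hd (u.coeff 0) (u.coeff (Finsupp.single 0 1))
    (u.coeff (Finsupp.single 1 1))
  rw [innerT_eq_setIntegral_convexHull] at h1
  have hone : ∀ p, evalP 1 p = 1 := fun p => by simp [evalP]
  simp only [hone, mul_one, evalP_of_totalDegree_le_one hu] at h1
  rw [h1, mul_zero] at e
  have := (mul_eq_zero.1 e.symm).resolve_right (setIntegral_bubble_pos hd).ne'
  rw [evalP_of_totalDegree_le_one hu, Prod.smul_fst, Prod.smul_snd, smul_eq_mul, smul_eq_mul]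
  linear_combination 3⁻¹ * this

lemma eq_zero_of_evalP_eq_zero {u : MvPolynomial (Fin 2) ℝ} (hu : u.totalDegree ≤ 1)
    {P Q R : ℝ × ℝ} (hPQR : ¬ Collinear ℝ {P, Q, R}) (hP : evalP u P = 0) (hQ : evalP u Q = 0)
    (hR : evalP u R = 0) : u = 0 := by
  have hd : det2 (P - Q) (R - Q) ≠ 0 := fun h => hPQR (collinear_of_det2_eq_zero h)
  rw [evalP_of_totalDegree_le_one hu] at hP hQ hR
  have hb : u.coeff (Finsupp.single 0 1) = 0 := by
    refine (mul_eq_zero.1 ?_).resolve_right hd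
    simp only [det2, Prod.fst_sub, Prod.snd_sub]
    linear_combination (R.2 - Q.2) * (hP - hQ) - (P.2 - Q.2) * (hR - hQ)
  have hc : u.coeff (Finsupp.single 1 1) = 0 := by
    refine (mul_eq_zero.1 ?_).resolve_right hd
    simp only [det2, Prod.fst_sub, Prod.snd_sub]
    linear_combination (P.1 - Q.1) * (hR - hQ) - (R.1 - Q.1) * (hP - hQ)
  have ha : u.coeff 0 = 0 := by simpa [hb, hc] using hP
  rw [← MvPolynomial.support_eq_empty, Finset.eq_empty_iff_forall_notMem]
  intro m hm
  have hm' := support_subset_of_totalDegree_le_one hu hm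
  simp only [Finset.mem_insert, Finset.mem_singleton] at hm'
  rcases hm' with rfl | rfl | rfl <;> exact MvPolynomial.mem_support_iff.1 hm ‹_›

/-- Let `𝒯` be a triangle patch around `z` and let `i` be an index such
that the barycenters of `K_{i-1}, K_i, K_{i+1}` are not collinear.  If `u` is a bivariate
polynomial of total degree at most `1` whose restriction to each of `K_{i-1}, K_i, K_{i+1}`
is orthogonal to the constants w.r.t. `(·,·)_{K_j}`, then `u = 0`; i.e.
`P_0^⊥(K_{i-1}) ∩ P_0^⊥(K_i) ∩ P_0^⊥(K_{i+1}) = {0}`. -/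
theorem statement15 (q : ℕ) (T : TrianglePatch q) (i : ZMod q)
    (hM : ¬ Collinear ℝ ({T.M (i - 1), T.M i, T.M (i + 1)} : Set (ℝ × ℝ)))
    (u : MvPolynomial (Fin 2) ℝ) (hu : u.totalDegree ≤ 1)
    (h1 : ∀ w : MvPolynomial (Fin 2) ℝ, w.totalDegree ≤ 0 →
      innerT T.z (T.A (i - 2)) (T.A (i - 1)) u w = 0)
    (h2 : ∀ w : MvPolynomial (Fin 2) ℝ, w.totalDegree ≤ 0 →
      innerT T.z (T.A (i - 1)) (T.A i) u w = 0)
    (h3 : ∀ w : MvPolynomial (Fin 2) ℝ, w.totalDegree ≤ 0 →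
      innerT T.z (T.A i) (T.A (i + 1)) u w = 0) :
    u = 0 := by
  have e1 : i - 1 - 1 = i - 2 := by ring
  have e2 : i + 1 - 1 = i := by ring
  have i1 := T.indep (i - 1)
  have i3 := T.indep (i + 1)
  rw [e1] at i1
  rw [e2] at i3
  refine eq_zero_of_evalP_eq_zero hu hM ?_ (affine_barycenter_eq_zero (T.indep i) hu h2) ?_
  · rw [TrianglePatch.M, e1]
    exact affine_barycenter_eq_zero i1 hu h1
  · rw [TrianglePatch.M, e2]
    exact affine_barycenter_eq_zero i3 hu h3
end
end

section
/- Let n > 1. Let T_1 = conv°((0,0),(1,0),(0,1)) be the unit triangle, K' = conv°((0,0),(1,−1),(1,0)), and K'' = conv°((0,0),(0,1),(−1,1)). Then P_{n−1}^⊥(K') ∩ P_{n−1}^⊥(T_1) ∩ P_{n−1}^⊥(K'') = {0}, the intersection being taken inside the space of bivariate polynomials of total degree ≤ n. -/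
open MeasureTheory Finset

noncomputable section

section

open MvPolynomial

theorem convexHull_unit_triangle :
    convexHull ℝ {((0 : ℝ), (0 : ℝ)), (1, 0), (0, 1)} =
      {p : ℝ × ℝ | 0 ≤ p.1 ∧ 0 ≤ p.2 ∧ p.1 + p.2 ≤ 1} := by
  apply Set.Subset.antisymm
  · refine convexHull_min ?_ ?_
    · rintro p (rfl | rfl | rfl) <;> norm_num
    · rintro ⟨a, b⟩ ⟨h1, h2, h3⟩ ⟨c, d⟩ ⟨h4, h5, h6⟩ s t hs ht hst
      simp only [Set.mem_ofPred_eq, Prod.smul_mk, Prod.mk_add_mk, smul_eq_mul] at *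
      exact ⟨by positivity, by positivity, by nlinarith⟩
  · rintro ⟨x, y⟩ ⟨hx, hy, hxy⟩
    simp only at hx hy hxy
    rw [convexHull_insert (Set.insert_nonempty _ _), convexHull_pair, mem_convexJoin]
    simp only [Set.mem_singleton_iff, exists_eq_left]
    rcases eq_or_lt_of_le (add_nonneg hx hy) with h | h
    · refine ⟨(1, 0), left_mem_segment _ _ _, ?_⟩
      have h1 : x = 0 := by linarith
      have h2 : y = 0 := by linarith
      subst h1 h2
      exact left_mem_segment _ _ _
    · refine ⟨(x / (x + y), y / (x + y)),
        ⟨x / (x + y), y / (x + y), by positivity, by positivity, by field_simp, by simp⟩,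
        ⟨1 - (x + y), x + y, by linarith, h.le, by ring, ?_⟩⟩
      ext <;> simp <;> field_simp

theorem tri_unit :
    tri (0, 0) (1, 0) (0, 1) = {p : ℝ × ℝ | 0 < p.1 ∧ 0 < p.2 ∧ p.1 + p.2 < 1} := by
  have e : {p : ℝ × ℝ | 0 ≤ p.1 ∧ 0 ≤ p.2 ∧ p.1 + p.2 ≤ 1} =
      (Prod.fst ⁻¹' Set.Ici 0) ∩ ((Prod.snd ⁻¹' Set.Ici 0) ∩
        ((ContinuousLinearMap.fst ℝ ℝ ℝ + ContinuousLinearMap.snd ℝ ℝ ℝ) ⁻¹' Set.Iic 1)) := by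
    ext p; simp
  have hs : Function.Surjective
      (ContinuousLinearMap.fst ℝ ℝ ℝ + ContinuousLinearMap.snd ℝ ℝ ℝ) :=
    fun a => ⟨(a, 0), by simp⟩
  rw [tri, convexHull_unit_triangle, e, interior_inter, interior_inter,
    ← isOpenMap_fst.preimage_interior_eq_interior_preimage continuous_fst,
    ← isOpenMap_snd.preimage_interior_eq_interior_preimage continuous_snd,
    ← (ContinuousLinearMap.isOpenMap _ hs).preimage_interior_eq_interior_preimage
      (ContinuousLinearMap.continuous _), interior_Ici, interior_Iic]
  ext p; simp

theorem tri_linear_image {a b c d : ℝ} (h : a * d - b * c = 1) :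
    tri (0, 0) (a, c) (b, d) =
      (fun p : ℝ × ℝ => (a * p.1 + b * p.2, c * p.1 + d * p.2)) '' tri (0, 0) (1, 0) (0, 1) := by
  let e : (ℝ × ℝ) ≃ₗ[ℝ] (ℝ × ℝ) :=
    { toFun := fun p => (a * p.1 + b * p.2, c * p.1 + d * p.2)
      invFun := fun p => (d * p.1 - b * p.2, -c * p.1 + a * p.2)
      map_add' := fun p q => by ext <;> simp <;> ring
      map_smul' := fun r p => by ext <;> simp <;> ring
      left_inv := fun p => by
        ext <;> simp
        · linear_combination p.1 * h
        · linear_combination p.2 * h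
      right_inv := fun p => by
        ext <;> simp
        · linear_combination p.1 * h
        · linear_combination p.2 * h }
  have h1 := e.toContinuousLinearEquiv.toHomeomorph.image_interior
    (convexHull ℝ {((0 : ℝ), (0 : ℝ)), (1, 0), (0, 1)})
  have h2 := LinearMap.image_convexHull (e : ℝ × ℝ →ₗ[ℝ] ℝ × ℝ)
    {((0 : ℝ), (0 : ℝ)), (1, 0), (0, 1)}
  change e '' _ = interior (e '' _) at h1
  change e '' _ = _ at h2
  rw [h2] at h1
  refine (Eq.trans h1 ?_).symm
  rw [tri]
  simp [Set.image_insert_eq, e]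

theorem measurePreserving_linear {a b c d : ℝ} (h : a * d - b * c = 1) :
    MeasurePreserving (fun p : ℝ × ℝ => (a * p.1 + b * p.2, c * p.1 + d * p.2))
      volume volume := by
  let f := Matrix.toLin (Module.Basis.finTwoProd ℝ) (Module.Basis.finTwoProd ℝ) !![a, b; c, d]
  have hd : LinearMap.det f = 1 := by
    simp [f, LinearMap.det_toLin, Matrix.det_fin_two, h]
  have hf : ⇑f = fun p : ℝ × ℝ => (a * p.1 + b * p.2, c * p.1 + d * p.2) := by
    ext p <;> simp [f, Matrix.toLin_finTwoProd_apply]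
  refine ⟨by fun_prop, ?_⟩
  rw [← hf, Measure.map_linearMap_addHaar_eq_smul_addHaar volume (by simp [hd]), hd]
  simp

theorem measurableEmbedding_linear {a b c d : ℝ} (h : a * d - b * c = 1) :
    MeasurableEmbedding (fun p : ℝ × ℝ => (a * p.1 + b * p.2, c * p.1 + d * p.2)) := by
  refine Continuous.measurableEmbedding (by fun_prop) ?_
  rintro ⟨x, y⟩ ⟨z, w⟩ hp
  simp only [Prod.mk.injEq] at hp ⊢
  obtain ⟨h1, h2⟩ := hp
  constructor
  · linear_combination d * h1 - b * h2 - (x - z) * h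
  · linear_combination a * h2 - c * h1 - (y - w) * h

/-- The linear substitution `(x, y) ↦ (a x + b y, c x + d y)` on bivariate polynomials. -/
def linSubst (a b c d : ℝ) : MvPolynomial (Fin 2) ℝ →ₐ[ℝ] MvPolynomial (Fin 2) ℝ :=
  bind₁ ![C a * X 0 + C b * X 1, C c * X 0 + C d * X 1]

theorem evalP_linSubst (a b c d : ℝ) (u : MvPolynomial (Fin 2) ℝ) (p : ℝ × ℝ) :
    evalP (linSubst a b c d u) p = evalP u (a * p.1 + b * p.2, c * p.1 + d * p.2) := by
  simp only [evalP, linSubst]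
  rw [← MvPolynomial.coe_aeval_eq_eval, ← MvPolynomial.coe_aeval_eq_eval]
  simp only [RingHom.coe_coe, aeval_bind₁]
  congr 2
  ext i
  fin_cases i <;> simp

theorem bubble_unit (p : ℝ × ℝ) :
    bubble (0, 0) (1, 0) (0, 1) p = (1 - p.1 - p.2) * p.1 * p.2 := by
  simp only [bubble, bary, det2, Prod.fst_sub, Prod.snd_sub]
  ring

theorem bubble_linear {a b c d : ℝ} (h : a * d - b * c = 1) (p : ℝ × ℝ) :
    bubble (0, 0) (a, c) (b, d) (a * p.1 + b * p.2, c * p.1 + d * p.2) =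
      bubble (0, 0) (1, 0) (0, 1) p := by
  rw [bubble_unit]
  have e1 : bary (0, 0) (a, c) (b, d) (a * p.1 + b * p.2, c * p.1 + d * p.2) =
      1 - p.1 - p.2 := by
    have : det2 ((0, 0) - (a, c)) ((b, d) - (a, c)) = -1 := by simp [det2]; linarith
    rw [bary, this]; simp [det2]
    linear_combination (1 - p.1 - p.2) * h
  have e2 : bary (a, c) (b, d) (0, 0) (a * p.1 + b * p.2, c * p.1 + d * p.2) = p.1 := by
    have : det2 ((a, c) - (b, d)) ((0, 0) - (b, d)) = -1 := by simp [det2]; linarith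
    rw [bary, this]; simp [det2]
    linear_combination (p.1) * h
  have e3 : bary (b, d) (0, 0) (a, c) (a * p.1 + b * p.2, c * p.1 + d * p.2) = p.2 := by
    have : det2 ((b, d) - (0, 0)) ((a, c) - (0, 0)) = -1 := by simp [det2]; linarith
    rw [bary, this]; simp [det2]
    linear_combination (p.2) * h
  rw [bubble, e1, e2, e3]

theorem innerT_linear {a b c d : ℝ} (h : a * d - b * c = 1) (u w : MvPolynomial (Fin 2) ℝ) :
    innerT (0, 0) (a, c) (b, d) u w =
      innerT (0, 0) (1, 0) (0, 1) (linSubst a b c d u) (linSubst a b c d w) := by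
  rw [innerT, tri_linear_image h,
    (measurePreserving_linear h).setIntegral_image_emb (measurableEmbedding_linear h)]
  simp only [innerT, evalP_linSubst, bubble_linear h]

theorem linSubst_linSubst {a b c d : ℝ} (h : a * d - b * c = 1) (u : MvPolynomial (Fin 2) ℝ) :
    linSubst a b c d (linSubst d (-b) (-c) a u) = u := by
  apply MvPolynomial.funext
  intro x
  have hx : x = ![x 0, x 1] := by ext i; fin_cases i <;> rfl
  rw [hx]
  change evalP _ (x 0, x 1) = evalP _ (x 0, x 1)
  rw [evalP_linSubst, evalP_linSubst]
  congr 2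
  · linear_combination x 0 * h
  · linear_combination x 1 * h

theorem totalDegree_linSubst_le (a b c d : ℝ) (u : MvPolynomial (Fin 2) ℝ) :
    (linSubst a b c d u).totalDegree ≤ u.totalDegree := by
  have hX : ∀ (r s : ℝ), (C r * X 0 + C s * X 1 : MvPolynomial (Fin 2) ℝ).totalDegree ≤ 1 := by
    intro r s
    refine (totalDegree_add _ _).trans (max_le ?_ ?_) <;>
    · refine (totalDegree_mul _ _).trans ?_
      simp
  rw [linSubst, bind₁, aeval_def, eval₂_eq']
  refine (totalDegree_finsetSum _ _).trans (Finset.sup_le fun m hm => ?_)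
  refine le_trans ?_ (le_totalDegree hm)
  refine (totalDegree_mul _ _).trans ?_
  rw [Fin.prod_univ_two, Finsupp.sum_fintype _ _ (fun _ => rfl), Fin.sum_univ_two]
  refine (add_le_add (totalDegree_C _).le (totalDegree_mul _ _)).trans ?_
  rw [zero_add]
  refine add_le_add ((totalDegree_pow _ _).trans ?_) ((totalDegree_pow _ _).trans ?_)
  · exact (Nat.mul_le_mul_left _ (hX a b)).trans (mul_one _).le
  · exact (Nat.mul_le_mul_left _ (hX c d)).trans (mul_one _).le

theorem inPerp_linSubst {n : ℕ} {a b c d : ℝ} (h : a * d - b * c = 1)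
    {u : MvPolynomial (Fin 2) ℝ} (hu : inPerp n (0, 0) (a, c) (b, d) u) :
    inPerp n (0, 0) (1, 0) (0, 1) (linSubst a b c d u) := by
  refine ⟨(totalDegree_linSubst_le _ _ _ _ _).trans hu.1, fun w hw => ?_⟩
  rw [← linSubst_linSubst h w, ← innerT_linear h]
  exact hu.2 _ ((totalDegree_linSubst_le _ _ _ _ _).trans hw)

theorem pderiv_zero_linSubst (a b c d : ℝ) (u : MvPolynomial (Fin 2) ℝ) :
    pderiv 0 (linSubst a b c d u) =
      linSubst a b c d (C a * pderiv 0 u + C c * pderiv 1 u) := by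
  induction u using MvPolynomial.induction_on with
  | C r => simp [linSubst]
  | add p q hp hq => simp only [map_add, hp, hq, mul_add]; ring
  | mul_X p i hp =>
    simp only [map_mul, Derivation.leibniz, hp, smul_eq_mul, map_add]
    fin_cases i <;> simp [linSubst] <;> ring

theorem pderiv_one_linSubst (a b c d : ℝ) (u : MvPolynomial (Fin 2) ℝ) :
    pderiv 1 (linSubst a b c d u) =
      linSubst a b c d (C b * pderiv 0 u + C d * pderiv 1 u) := by
  induction u using MvPolynomial.induction_on with
  | C r => simp [linSubst]
  | add p q hp hq => simp only [map_add, hp, hq, mul_add]; ring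
  | mul_X p i hp =>
    simp only [map_mul, Derivation.leibniz, hp, smul_eq_mul, map_add]
    fin_cases i <;> simp [linSubst] <;> ring

theorem integral_pow_mul_one_sub_pow (p q : ℕ) :
    ∫ x in (0 : ℝ)..1, x ^ p * (1 - x) ^ q =
      (p.factorial * q.factorial : ℝ) / (p + q + 1).factorial := by
  induction q generalizing p with
  | zero =>
    simp [integral_pow, Nat.factorial_succ]
    field_simp
  | succ q ih =>
    have h : ∫ x in (0 : ℝ)..1, ((p + 1) * (x ^ p * (1 - x) ^ (q + 1)) -
        (q + 1) * (x ^ (p + 1) * (1 - x) ^ q)) = 0 := by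
      rw [intervalIntegral.integral_eq_sub_of_hasDerivAt
        (f := fun x : ℝ => x ^ (p + 1) * (1 - x) ^ (q + 1))]
      · simp
      · intro x _
        have := ((hasDerivAt_pow (p + 1) x).mul (((hasDerivAt_id x).const_sub 1).pow (q + 1)))
        convert! this using 1
        simp
        ring
      · exact Continuous.intervalIntegrable (by fun_prop) _ _
    rw [intervalIntegral.integral_sub (Continuous.intervalIntegrable (by fun_prop) _ _)
      (Continuous.intervalIntegrable (by fun_prop) _ _), intervalIntegral.integral_const_mul,
      intervalIntegral.integral_const_mul, ih, sub_eq_zero] at h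
    have h2 : (p + 1 : ℝ) ≠ 0 := by positivity
    rw [← mul_right_inj' h2, h]
    rw [show p + 1 + q + 1 = p + (q + 1) + 1 by ring]
    simp only [Nat.factorial_succ, Nat.cast_mul, Nat.cast_add, Nat.cast_one]
    ring

theorem measurableSet_tri (A B C : ℝ × ℝ) : MeasurableSet (tri A B C) :=
  isOpen_interior.measurableSet

theorem integrableOn_tri_unit {f : ℝ × ℝ → ℝ} (hf : Continuous f) :
    IntegrableOn f (tri (0, 0) (1, 0) (0, 1)) := by
  refine (hf.continuousOn.integrableOn_compact
    (isCompact_Icc (a := ((0 : ℝ), (0 : ℝ))) (b := ((1 : ℝ), (1 : ℝ))))).mono_set ?_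
  rw [tri_unit]
  rintro ⟨x, y⟩ ⟨h1, h2, h3⟩
  simp only at h1 h2 h3
  refine ⟨⟨h1.le, h2.le⟩, ⟨?_, ?_⟩⟩ <;> simp only <;> linarith

theorem integral_tri_unit {f : ℝ × ℝ → ℝ} (hf : Continuous f) :
    ∫ p in tri (0, 0) (1, 0) (0, 1), f p =
      ∫ x in (0 : ℝ)..1, ∫ y in (0 : ℝ)..(1 - x), f (x, y) := by
  have hm := measurableSet_tri (0, 0) (1, 0) (0, 1)
  rw [← integral_indicator hm, Measure.volume_eq_prod,
    integral_prod _ (by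
      rw [← Measure.volume_eq_prod]; exact (integrableOn_tri_unit hf).integrable_indicator hm),
    intervalIntegral.integral_of_le zero_le_one, integral_Ioc_eq_integral_Ioo,
    ← integral_indicator measurableSet_Ioo]
  congr 1
  ext x
  by_cases hx : x ∈ Set.Ioo (0 : ℝ) 1
  · rw [Set.indicator_of_mem hx, intervalIntegral.integral_of_le (by linarith [hx.2]),
      integral_Ioc_eq_integral_Ioo, ← integral_indicator measurableSet_Ioo]
    congr 1
    ext y
    rw [tri_unit]
    refine Set.indicator_eq_indicator (f := f) (g := fun y => f (x, y)) ?_ rfl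
    simp only [Set.mem_ofPred_eq, Set.mem_Ioo]
    exact ⟨fun h => ⟨h.2.1, by linarith⟩, fun h => ⟨hx.1, h.1, by linarith⟩⟩
  · rw [Set.indicator_of_notMem hx]
    refine integral_eq_zero_of_ae (Filter.Eventually.of_forall fun y => ?_)
    rw [tri_unit]
    refine Set.indicator_of_notMem ?_ _
    rintro ⟨h1, h2, h3⟩
    exact hx ⟨h1, by simp only at h2 h3; linarith⟩

theorem integral_tri_unit_monomial (p q : ℕ) :
    ∫ z in tri (0, 0) (1, 0) (0, 1), z.1 ^ p * z.2 ^ q * (1 - z.1 - z.2) =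
      (p.factorial * q.factorial : ℝ) / (p + q + 3).factorial := by
  rw [integral_tri_unit (by fun_prop)]
  have h : ∀ x : ℝ, ∫ y in (0 : ℝ)..(1 - x), x ^ p * y ^ q * (1 - x - y) =
      (1 / ((q + 1) * (q + 2))) * (x ^ p * (1 - x) ^ (q + 2)) := by
    intro x
    have : ∀ y : ℝ, x ^ p * y ^ q * (1 - x - y) =
      x ^ p * (1 - x) * y ^ q - x ^ p * y ^ (q + 1) := fun y => by ring
    simp_rw [this]
    rw [intervalIntegral.integral_sub (Continuous.intervalIntegrable (by fun_prop) _ _)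
      (Continuous.intervalIntegrable (by fun_prop) _ _), intervalIntegral.integral_const_mul,
      intervalIntegral.integral_const_mul, integral_pow, integral_pow]
    push_cast
    field_simp
    ring
  simp_rw [h]
  rw [intervalIntegral.integral_const_mul, integral_pow_mul_one_sub_pow]
  rw [show p + (q + 2) + 1 = p + q + 3 by ring]
  simp only [Nat.factorial_succ, Nat.cast_mul, Nat.cast_add, Nat.cast_one]
  field_simp
  ring

theorem continuous_evalP (u : MvPolynomial (Fin 2) ℝ) : Continuous (evalP u) := by
  unfold evalP
  refine (MvPolynomial.continuous_eval u).comp (continuous_pi fun i => ?_)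
  fin_cases i <;> simp <;> fun_prop

/-- The integral of a polynomial against the cubic bubble over the unit triangle, as a linear
functional. -/
def bubbleIntegral : MvPolynomial (Fin 2) ℝ →ₗ[ℝ] ℝ where
  toFun u := ∫ p in tri (0, 0) (1, 0) (0, 1), evalP u p * ((1 - p.1 - p.2) * p.1 * p.2)
  map_add' u v := by
    rw [← integral_add]
    · simp only [evalP, map_add, add_mul]
    all_goals
      have := continuous_evalP u
      have := continuous_evalP v
      exact integrableOn_tri_unit (by fun_prop)
  map_smul' r u := by
    simp [evalP, mul_assoc, integral_const_mul]

theorem innerT_unit (u v : MvPolynomial (Fin 2) ℝ) :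
    innerT (0, 0) (1, 0) (0, 1) u v = bubbleIntegral (u * v) := by
  simp [innerT, bubbleIntegral, bubble_unit, evalP]

theorem bubbleIntegral_monomial (i j : ℕ) :
    bubbleIntegral (X 0 ^ i * X 1 ^ j) =
      ((i + 1).factorial * (j + 1).factorial : ℝ) / (i + j + 5).factorial := by
  rw [show i + j + 5 = (i + 1) + (j + 1) + 3 by ring, ← integral_tri_unit_monomial]
  simp only [bubbleIntegral, evalP, LinearMap.coe_mk, AddHom.coe_mk]
  congr 1
  ext p
  simp
  ring

theorem eq_zero_of_bubbleIntegral_mul_self {u : MvPolynomial (Fin 2) ℝ}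
    (hu : bubbleIntegral (u * u) = 0) : u = 0 := by
  have hc := continuous_evalP u
  have hm := measurableSet_tri (0, 0) (1, 0) (0, 1)
  set f : ℝ × ℝ → ℝ := fun p => evalP u p * evalP u p * ((1 - p.1 - p.2) * p.1 * p.2) with hf
  have hfc : Continuous f := by fun_prop
  have h0 : ∫ p in tri (0, 0) (1, 0) (0, 1), f p = 0 := by
    simpa [bubbleIntegral, evalP, hf] using hu
  have hpos : ∀ p ∈ tri (0, 0) (1, 0) (0, 1), 0 < (1 - p.1 - p.2) * p.1 * p.2 := by
    rw [tri_unit]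
    rintro p ⟨h1, h2, h3⟩
    have : 0 < 1 - p.1 - p.2 := by linarith
    positivity
  rw [integral_eq_zero_iff_of_nonneg_ae
    ((ae_restrict_iff' hm).2 (Filter.Eventually.of_forall fun p hp =>
      mul_nonneg (mul_self_nonneg _) (hpos p hp).le)) (integrableOn_tri_unit hfc)] at h0
  have h1 : Set.EqOn f 0 (tri (0, 0) (1, 0) (0, 1)) :=
    Measure.eqOn_open_of_ae_eq h0 isOpen_interior hfc.continuousOn continuousOn_const
  refine MvPolynomial.funext_set (fun _ => Set.Ioo (0 : ℝ) (1 / 2))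
    (fun _ => Set.Ioo_infinite (by norm_num)) fun x hx => ?_
  have hx0 := hx 0 trivial
  have hx1 := hx 1 trivial
  have hmem : (x 0, x 1) ∈ tri (0, 0) (1, 0) (0, 1) := by
    rw [tri_unit]
    exact ⟨hx0.1, hx1.1, by simp only; linarith [hx0.2, hx1.2]⟩
  have h2 := h1 hmem
  have h3 : evalP u (x 0, x 1) = 0 := by
    simpa [hf, (hpos _ hmem).ne'] using h2
  have h4 : x = ![x 0, x 1] := by ext i; fin_cases i <;> rfl
  rw [map_zero, h4]
  exact h3

/-- The Euler operator `x ∂ₓ + y ∂_y`. -/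
def euler (u : MvPolynomial (Fin 2) ℝ) : MvPolynomial (Fin 2) ℝ :=
  X 0 * pderiv 0 u + X 1 * pderiv 1 u

/-- The second order operator on the unit triangle that is symmetric with respect to the weight
`xy(1 - x - y)` and has the orthogonal polynomials of degree `n` as eigenvectors, with
eigenvalue `-n(n + 5)`. -/
def jacobiOp (u : MvPolynomial (Fin 2) ℝ) : MvPolynomial (Fin 2) ℝ :=
  pderiv 0 (pderiv 0 (X 0 * u)) + pderiv 1 (pderiv 1 (X 1 * u)) - euler (euler u) - 5 * euler u

theorem monomial_eq_X_pow (m : Fin 2 →₀ ℕ) :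
    (monomial m 1 : MvPolynomial (Fin 2) ℝ) = X 0 ^ m 0 * X 1 ^ m 1 := by
  rw [monomial_eq, Finsupp.prod_fintype _ _ (fun _ => pow_zero _), Fin.prod_univ_two]
  simp

theorem linearMap_eq_zero_of_X_pow {φ : MvPolynomial (Fin 2) ℝ →ₗ[ℝ] ℝ}
    (h : ∀ i j, φ (X 0 ^ i * X 1 ^ j) = 0) : φ = 0 := by
  refine (basisMonomials (Fin 2) ℝ).ext fun m => ?_
  simp only [coe_basisMonomials, monomial_eq_X_pow]
  exact h _ _

theorem bubbleIntegral_div_zero (f : MvPolynomial (Fin 2) ℝ) :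
    bubbleIntegral (X 0 * (1 - X 0) * pderiv 0 f - X 0 * X 1 * pderiv 1 f +
      (2 - 6 * X 0) * f) = 0 := by
  let D : MvPolynomial (Fin 2) ℝ →ₗ[ℝ] MvPolynomial (Fin 2) ℝ :=
    LinearMap.mulLeft ℝ (X 0 * (1 - X 0)) ∘ₗ (pderiv 0).toLinearMap -
      LinearMap.mulLeft ℝ (X 0 * X 1) ∘ₗ (pderiv 1).toLinearMap +
      LinearMap.mulLeft ℝ (2 - 6 * X 0)
  suffices h : bubbleIntegral ∘ₗ D = 0 from LinearMap.congr_fun h f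
  refine linearMap_eq_zero_of_X_pow fun i j => ?_
  have e : D (X 0 ^ i * X 1 ^ j) = ((i : ℝ) + 2) • (X 0 ^ i * X 1 ^ j) -
      ((i : ℝ) + j + 6) • (X 0 ^ (i + 1) * X 1 ^ j) := by
    simp only [D, LinearMap.add_apply, LinearMap.sub_apply, LinearMap.comp_apply,
      LinearMap.mulLeft_apply, Derivation.coeFn_coe, smul_eq_C_mul]
    have h2 : (C 2 : MvPolynomial (Fin 2) ℝ) = 2 := rfl
    have h6 : (C 6 : MvPolynomial (Fin 2) ℝ) = 6 := rfl
    rcases i with _ | i <;> rcases j with _ | j <;> simp [h2, h6] <;> ring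
  rw [LinearMap.comp_apply, e, map_sub, map_smul, map_smul, bubbleIntegral_monomial,
    bubbleIntegral_monomial, show i + 1 + j + 5 = i + j + 5 + 1 by ring]
  simp only [Nat.factorial_succ, Nat.cast_mul, Nat.cast_add, Nat.cast_one, smul_eq_mul]
  push_cast
  field_simp
  ring

theorem bubbleIntegral_div_one (f : MvPolynomial (Fin 2) ℝ) :
    bubbleIntegral (X 1 * (1 - X 1) * pderiv 1 f - X 0 * X 1 * pderiv 0 f +
      (2 - 6 * X 1) * f) = 0 := by
  let D : MvPolynomial (Fin 2) ℝ →ₗ[ℝ] MvPolynomial (Fin 2) ℝ :=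
    LinearMap.mulLeft ℝ (X 1 * (1 - X 1)) ∘ₗ (pderiv 1).toLinearMap -
      LinearMap.mulLeft ℝ (X 0 * X 1) ∘ₗ (pderiv 0).toLinearMap +
      LinearMap.mulLeft ℝ (2 - 6 * X 1)
  suffices h : bubbleIntegral ∘ₗ D = 0 from LinearMap.congr_fun h f
  refine linearMap_eq_zero_of_X_pow fun i j => ?_
  have e : D (X 0 ^ i * X 1 ^ j) = ((j : ℝ) + 2) • (X 0 ^ i * X 1 ^ j) -
      ((i : ℝ) + j + 6) • (X 0 ^ i * X 1 ^ (j + 1)) := by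
    simp only [D, LinearMap.add_apply, LinearMap.sub_apply, LinearMap.comp_apply,
      LinearMap.mulLeft_apply, Derivation.coeFn_coe, smul_eq_C_mul]
    have h2 : (C 2 : MvPolynomial (Fin 2) ℝ) = 2 := rfl
    have h6 : (C 6 : MvPolynomial (Fin 2) ℝ) = 6 := rfl
    rcases i with _ | i <;> rcases j with _ | j <;> simp [h2, h6] <;> ring
  rw [LinearMap.comp_apply, e, map_sub, map_smul, map_smul, bubbleIntegral_monomial,
    bubbleIntegral_monomial, show i + (j + 1) + 5 = i + j + 5 + 1 by ring]
  simp only [Nat.factorial_succ, Nat.cast_mul, Nat.cast_add, Nat.cast_one, smul_eq_mul]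
  push_cast
  field_simp
  ring

theorem pderiv_comm (u : MvPolynomial (Fin 2) ℝ) :
    pderiv 1 (pderiv 0 u) = pderiv 0 (pderiv 1 u) := by
  ext m
  simp only [coeff_pderiv, Finsupp.add_apply, add_right_comm m]
  simp
  ring

theorem bubbleIntegral_mul_jacobiOp (u v : MvPolynomial (Fin 2) ℝ) :
    bubbleIntegral (v * jacobiOp u) = bubbleIntegral (u * jacobiOp v) := by
  have h0 := bubbleIntegral_div_zero (v * pderiv 0 u - u * pderiv 0 v)
  have h1 := bubbleIntegral_div_one (v * pderiv 1 u - u * pderiv 1 v)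
  rw [← sub_eq_zero, ← map_sub, ← add_zero (0 : ℝ), ← h0.trans (add_zero 0).symm]
  nth_rewrite 2 [← add_zero (bubbleIntegral _)]
  rw [← h1, ← map_add]
  congr 1
  simp [jacobiOp, euler, pderiv_comm]
  ring

theorem coeff_X_mul_pderiv (i : Fin 2) (u : MvPolynomial (Fin 2) ℝ) (m : Fin 2 →₀ ℕ) :
    coeff m (X i * pderiv i u) = m i * coeff m u := by
  induction u using MvPolynomial.induction_on' with
  | monomial k r =>
    rw [X_mul_pderiv_monomial, nsmul_eq_mul, ← map_natCast (C : ℝ →+* _), coeff_C_mul,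
      coeff_monomial]
    split_ifs with h
    · rw [h]
    · simp
  | add p q hp hq => simp only [map_add, mul_add, coeff_add, hp, hq]

theorem coeff_euler (u : MvPolynomial (Fin 2) ℝ) (m : Fin 2 →₀ ℕ) :
    coeff m (euler u) = (m 0 + m 1) * coeff m u := by
  rw [euler, coeff_add, coeff_X_mul_pderiv, coeff_X_mul_pderiv, add_mul]

theorem coeff_pderiv_pderiv_X_mul (i j : Fin 2) (u : MvPolynomial (Fin 2) ℝ) (m : Fin 2 →₀ ℕ) :
    coeff m (pderiv j (pderiv i (X i * u))) =
      coeff (m + Finsupp.single j 1) u * ((m + Finsupp.single j 1 : Fin 2 →₀ ℕ) i + 1) *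
        (m j + 1) := by
  rw [coeff_pderiv, coeff_pderiv, add_comm _ (Finsupp.single i 1), coeff_X_mul]

theorem coeff_jacobiOp (u : MvPolynomial (Fin 2) ℝ) (m : Fin 2 →₀ ℕ) :
    coeff m (jacobiOp u) = coeff (m + Finsupp.single 0 1) u * (m 0 + 2) * (m 0 + 1) +
      coeff (m + Finsupp.single 1 1) u * (m 1 + 2) * (m 1 + 1) -
      (m 0 + m 1) * (m 0 + m 1 + 5) * coeff m u := by
  rw [jacobiOp, show (5 : MvPolynomial (Fin 2) ℝ) = C 5 from rfl, coeff_sub, coeff_sub, coeff_add,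
    coeff_pderiv_pderiv_X_mul, coeff_pderiv_pderiv_X_mul, coeff_C_mul, coeff_euler, coeff_euler]
  simp
  ring

theorem totalDegree_le_iff_coeff {u : MvPolynomial (Fin 2) ℝ} {n : ℕ} :
    u.totalDegree ≤ n ↔ ∀ m : Fin 2 →₀ ℕ, n < m 0 + m 1 → coeff m u = 0 := by
  have hs (m : Fin 2 →₀ ℕ) : (m.sum fun _ e => e) = m 0 + m 1 := by
    rw [Finsupp.sum_fintype _ _ (fun _ => rfl), Fin.sum_univ_two]
  simp only [totalDegree, Finset.sup_le_iff, mem_support_iff, hs]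
  exact forall_congr' fun m => by rw [← not_imp_not, not_le, not_not]

theorem totalDegree_jacobiOp_le {n : ℕ} {u : MvPolynomial (Fin 2) ℝ} (hu : u.totalDegree ≤ n) :
    (jacobiOp u).totalDegree ≤ n := by
  rw [totalDegree_le_iff_coeff] at hu ⊢
  intro m hm
  rw [coeff_jacobiOp, hu m hm, hu, hu]
  · simp
  all_goals simp; omega

theorem totalDegree_jacobiOp_add_le {n : ℕ} (hn : 0 < n) {u : MvPolynomial (Fin 2) ℝ}
    (hu : u.totalDegree ≤ n) :
    (jacobiOp u + C ((n : ℝ) * (n + 5)) * u).totalDegree ≤ n - 1 := by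
  rw [totalDegree_le_iff_coeff] at hu ⊢
  intro m hm
  rw [coeff_add, coeff_C_mul, coeff_jacobiOp, hu (m + Finsupp.single 0 1),
    hu (m + Finsupp.single 1 1)]
  · rcases eq_or_lt_of_le (show n ≤ m 0 + m 1 by omega) with h | h
    · rw [h]; push_cast; ring
    · rw [hu m h]; simp
  all_goals simp; omega

theorem jacobiOp_eq_of_inPerp {n : ℕ} (hn : 0 < n) {u : MvPolynomial (Fin 2) ℝ}
    (hu : inPerp n (0, 0) (1, 0) (0, 1) u) :
    jacobiOp u + C ((n : ℝ) * (n + 5)) * u = 0 := by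
  set w := jacobiOp u + C ((n : ℝ) * (n + 5)) * u with hw
  have hwd : w.totalDegree ≤ n - 1 := totalDegree_jacobiOp_add_le hn hu.1
  have h1 := hu.2 w hwd
  have h2 := hu.2 _ (totalDegree_jacobiOp_le hwd)
  rw [innerT_unit] at h1 h2
  refine eq_zero_of_bubbleIntegral_mul_self ?_
  have e : w * w = w * jacobiOp u + ((n : ℝ) * (n + 5)) • (u * w) := by
    rw [smul_eq_C_mul]
    nth_rewrite 2 [hw]
    ring
  rw [e, map_add, map_smul, bubbleIntegral_mul_jacobiOp, h1, h2]
  simp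

theorem linSubst_injective {a b c d : ℝ} (h : a * d - b * c = 1) :
    Function.Injective (linSubst a b c d) := by
  intro u v huv
  have h' : d * a - (-b) * (-c) = 1 := by linarith
  have key := linSubst_linSubst h'
  simp only [neg_neg] at key
  rw [← key u, huv, key v]

theorem euler_linSubst {a b c d : ℝ} (u : MvPolynomial (Fin 2) ℝ) :
    euler (linSubst a b c d u) = linSubst a b c d (euler u) := by
  simp only [euler, pderiv_zero_linSubst, pderiv_one_linSubst, map_add, map_mul]
  simp [linSubst]
  ring

theorem linSubst_C (a b c d r : ℝ) : linSubst a b c d (C r) = C r := by simp [linSubst]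

theorem jacobiOp_linSubst_lower (u : MvPolynomial (Fin 2) ℝ) :
    jacobiOp (linSubst 1 1 (-1) 0 u) = linSubst 1 1 (-1) 0 (jacobiOp u +
      2 * (pderiv 0 (pderiv 1 (X 1 * u)) - pderiv 1 (pderiv 1 (X 1 * u)))) := by
  have h0 (w : MvPolynomial (Fin 2) ℝ) : X 0 * linSubst 1 1 (-1) 0 w =
      linSubst 1 1 (-1) 0 ((-X 1) * w) := by simp [linSubst]
  have h1 (w : MvPolynomial (Fin 2) ℝ) : X 1 * linSubst 1 1 (-1) 0 w =
      linSubst 1 1 (-1) 0 ((X 0 + X 1) * w) := by simp [linSubst]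
  have h5 (w : MvPolynomial (Fin 2) ℝ) : 5 * linSubst 1 1 (-1) 0 w =
      linSubst 1 1 (-1) 0 (5 * w) := by rw [map_mul, map_ofNat]
  simp only [jacobiOp, euler_linSubst, h5, h0, h1, pderiv_zero_linSubst, pderiv_one_linSubst]
  rw [← map_add, ← map_sub, ← map_sub]
  refine congrArg _ ?_
  simp [pderiv_comm]
  ring

theorem jacobiOp_linSubst_upper (u : MvPolynomial (Fin 2) ℝ) :
    jacobiOp (linSubst 0 (-1) 1 1 u) = linSubst 0 (-1) 1 1 (jacobiOp u +
      2 * (pderiv 1 (pderiv 0 (X 0 * u)) - pderiv 0 (pderiv 0 (X 0 * u)))) := by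
  have h0 (w : MvPolynomial (Fin 2) ℝ) : X 0 * linSubst 0 (-1) 1 1 w =
      linSubst 0 (-1) 1 1 ((X 0 + X 1) * w) := by simp [linSubst]
  have h1 (w : MvPolynomial (Fin 2) ℝ) : X 1 * linSubst 0 (-1) 1 1 w =
      linSubst 0 (-1) 1 1 ((-X 0) * w) := by simp [linSubst]
  have h5 (w : MvPolynomial (Fin 2) ℝ) : 5 * linSubst 0 (-1) 1 1 w =
      linSubst 0 (-1) 1 1 (5 * w) := by rw [map_mul, map_ofNat]
  simp only [jacobiOp, euler_linSubst, h5, h0, h1, pderiv_zero_linSubst, pderiv_one_linSubst]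
  rw [← map_add, ← map_sub, ← map_sub]
  refine congrArg _ ?_
  simp [pderiv_comm]
  ring

theorem pderiv_eq_of_inPerp_lower {n : ℕ} (hn : 0 < n) {u : MvPolynomial (Fin 2) ℝ}
    (h1 : inPerp n (0, 0) (1, -1) (1, 0) u) (h2 : inPerp n (0, 0) (1, 0) (0, 1) u) :
    pderiv 0 (pderiv 1 (X 1 * u)) = pderiv 1 (pderiv 1 (X 1 * u)) := by
  have hd : (1 : ℝ) * 0 - 1 * (-1) = 1 := by norm_num
  have e2 := jacobiOp_eq_of_inPerp hn h2
  have e1 := jacobiOp_eq_of_inPerp hn (inPerp_linSubst hd h1)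
  rw [jacobiOp_linSubst_lower, ← linSubst_C 1 1 (-1) 0, ← map_mul, ← map_add,
    map_eq_zero_iff _ (linSubst_injective hd)] at e1
  exact sub_eq_zero.1 ((mul_eq_zero.1 (by linear_combination e1 - e2)).resolve_left
    (two_ne_zero (α := MvPolynomial (Fin 2) ℝ)))

theorem pderiv_eq_of_inPerp_upper {n : ℕ} (hn : 0 < n) {u : MvPolynomial (Fin 2) ℝ}
    (h2 : inPerp n (0, 0) (1, 0) (0, 1) u) (h3 : inPerp n (0, 0) (0, 1) (-1, 1) u) :
    pderiv 1 (pderiv 0 (X 0 * u)) = pderiv 0 (pderiv 0 (X 0 * u)) := by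
  have hd : (0 : ℝ) * 1 - (-1) * 1 = 1 := by norm_num
  have e2 := jacobiOp_eq_of_inPerp hn h2
  have e1 := jacobiOp_eq_of_inPerp hn (inPerp_linSubst hd h3)
  rw [jacobiOp_linSubst_upper, ← linSubst_C 0 (-1) 1 1, ← map_mul, ← map_add,
    map_eq_zero_iff _ (linSubst_injective hd)] at e1
  exact sub_eq_zero.1 ((mul_eq_zero.1 (by linear_combination e1 - e2)).resolve_left
    (two_ne_zero (α := MvPolynomial (Fin 2) ℝ)))

theorem eq_C_of_pderiv_eq {u : MvPolynomial (Fin 2) ℝ}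
    (h1 : pderiv 0 (pderiv 1 (X 1 * u)) = pderiv 1 (pderiv 1 (X 1 * u)))
    (h2 : pderiv 1 (pderiv 0 (X 0 * u)) = pderiv 0 (pderiv 0 (X 0 * u))) :
    u = C (coeff 0 u) := by
  have key : ∀ m : Fin 2 →₀ ℕ, coeff (m + Finsupp.single 0 1) u = 0 ∧
      coeff (m + Finsupp.single 1 1) u = 0 := by
    intro m
    have e1 := congrArg (coeff m) h1
    have e2 := congrArg (coeff m) h2
    rw [coeff_pderiv_pderiv_X_mul, coeff_pderiv_pderiv_X_mul] at e1 e2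
    simp at e1 e2
    have p0 : (0 : ℝ) ≤ m 0 := Nat.cast_nonneg _
    have p1 : (0 : ℝ) ≤ m 1 := Nat.cast_nonneg _
    generalize (m 0 : ℝ) = i at *
    generalize (m 1 : ℝ) = j at *
    generalize coeff (m + Finsupp.single 0 1) u = a at *
    generalize coeff (m + Finsupp.single 1 1) u = b at *
    have q0 : i + 1 ≠ 0 := by positivity
    have q1 : j + 1 ≠ 0 := by positivity
    have f1 : a * (i + 1) = b * (j + 2) := mul_right_cancel₀ q1 (by linear_combination e1)
    have f2 : b * (j + 1) = a * (i + 2) := mul_right_cancel₀ q0 (by linear_combination e2)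
    have f3 : (i + j + 3) * a = 0 := by linear_combination -(j + 1) * f1 - (j + 2) * f2
    have ha : a = 0 := (mul_eq_zero.1 f3).resolve_left (by positivity)
    rw [ha, zero_mul] at f2
    exact ⟨ha, (mul_eq_zero.1 f2).resolve_right q1⟩
  ext m
  rw [coeff_C]
  split_ifs with h
  · rw [h]
  · obtain ⟨i, hi⟩ : ∃ i, m i ≠ 0 := by
      by_contra! hc
      exact h (Finsupp.ext fun i => (hc i).symm)
    have hm : m = (m - Finsupp.single i 1) + Finsupp.single i 1 :=
      (tsub_add_cancel_of_le (Finsupp.single_le_iff.2 (Nat.one_le_iff_ne_zero.2 hi))).symm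
    rw [hm]
    fin_cases i
    · exact (key _).1
    · exact (key _).2

end

/-- Let `n > 1`, `T₁ = conv°((0,0),(1,0),(0,1))`,
`K' = conv°((0,0),(1,-1),(1,0))` and `K'' = conv°((0,0),(0,1),(-1,1))`.  Then
`P_{n-1}^⊥(K') ∩ P_{n-1}^⊥(T₁) ∩ P_{n-1}^⊥(K'') = {0}` inside the bivariate polynomials
of total degree at most `n`. -/
theorem statement16 (n : ℕ) (hn : 1 < n) (u : MvPolynomial (Fin 2) ℝ)
    (h1 : inPerp n (0, 0) (1, -1) (1, 0) u)
    (h2 : inPerp n (0, 0) (1, 0) (0, 1) u)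
    (h3 : inPerp n (0, 0) (0, 1) (-1, 1) u) :
    u = 0 := by
  have hn' : 0 < n := by omega
  have hu := eq_C_of_pderiv_eq (pderiv_eq_of_inPerp_lower hn' h1 h2)
    (pderiv_eq_of_inPerp_upper hn' h2 h3)
  refine eq_zero_of_bubbleIntegral_mul_self ?_
  rw [← innerT_unit]
  exact h2.2 u (by rw [hu, MvPolynomial.totalDegree_C]; exact Nat.zero_le _)
end
end
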